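/- The electric potential of a knot always has at least one critical point in ℝ³: there exists x ∉ K with gradient Φ x = 0 (equivalently fderiv ℝ Φ x = 0). (This is the finite part of the bound cp(K) ≥ 2t(K) + 2 ≥ 2, one of whose critical points is the point at infinity.) -/

import Mathlib

open Set Filter Topology

/-- A continuous self-map of the plane fixing the unit circle pointwise has a zero in the unit
disk. -/
theorem exists_zero_of_fix_circle {g : ℂ → ℂ} (hg : Continuous g)
    (h : ∀ t : ℝ, g (Circle.exp t) = Circle.exp t) :
    ∃ z ∈ Metric.closedBall (0 : ℂ) 1, g z = 0 := by
  by_contra! hne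
  let ρ : ℂ → ℂ := fun z ↦ ((max 1 ‖z‖)⁻¹ : ℝ) • z
  have hpos : ∀ z : ℂ, 0 < max 1 ‖z‖ := fun z ↦ lt_max_of_lt_left one_pos
  have hρ : Continuous ρ :=
    ((continuous_const.max continuous_norm).inv₀ fun z ↦ (hpos z).ne').smul continuous_id
  have hρ_mem : ∀ z, ρ z ∈ Metric.closedBall (0 : ℂ) 1 := fun z ↦ by
    rw [mem_closedBall_zero_iff, norm_smul, norm_inv, Real.norm_of_nonneg (hpos z).le,
      inv_mul_le_one₀ (hpos z)]
    exact le_max_right _ _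
  have hsimply : IsSimplyConnected (univ : Set ℂ) := by
    have := (convex_univ (𝕜 := ℝ) (E := ℂ)).contractibleSpace univ_nonempty
    exact SimplyConnectedSpace.ofContractible _
  obtain ⟨l, hl, hle⟩ := Complex.exists_continuousOn_eqOn_exp_comp (g := g ∘ ρ)
    hsimply isOpen_univ
    (hg.comp hρ).continuousOn (by rintro ⟨z, -, hz⟩; exact hne _ (hρ_mem z) hz)
  rw [continuousOn_univ] at hl
  have hexp : ∀ t : ℝ, Complex.exp (l (Circle.exp t)) = Complex.exp (t * Complex.I) := fun t ↦ by
    have := hle (mem_univ (Circle.exp t : ℂ))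
    simp only [Function.comp_apply, ρ, Circle.norm_coe, max_self, inv_one, one_smul, h] at this
    rw [this, Circle.coe_exp]
  let w : ℝ → ℂ := fun t ↦ (l (Circle.exp t) - t * Complex.I) / (2 * Real.pi * Complex.I)
  have hw : Continuous w := by fun_prop
  have hwint : ∀ t, ∃ n : ℤ, w t = n := fun t ↦ by
    obtain ⟨n, hn⟩ := Complex.exp_eq_exp_iff_exists_int.1 (hexp t)
    refine ⟨n, ?_⟩
    simp only [w, hn, add_sub_cancel_left]
    exact mul_div_cancel_right₀ _ Complex.two_pi_I_ne_zero
  choose n hn using hwint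
  have hnc : Continuous n := by
    rw [Int.isClosedEmbedding_coe_real.isInducing.continuous_iff]
    refine (Complex.continuous_re.comp hw).congr fun t ↦ ?_
    simp [hn]
  have hconst := (PreconnectedSpace.constant (inferInstance : PreconnectedSpace ℝ) hnc
    : n 0 = n (2 * Real.pi))
  have hw' : w 0 = w (2 * Real.pi) := by rw [hn, hn, hconst]
  simp only [w, Circle.exp_zero, Circle.exp_two_pi] at hw'
  simp [sub_div, eq_sub_iff_add_eq] at hw'

section

variable {E : Type*} [NormedAddCommGroup E] {r : ℝ → E}

/-- A loop in a finite-dimensional space extends to a continuous map from the plane. -/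
theorem exists_continuous_extend_loop [NormedSpace ℝ E] [FiniteDimensional ℝ E] (hr : Continuous r)
    (hper : Function.Periodic r (2 * Real.pi)) :
    ∃ f : ℂ → E, Continuous f ∧ ∀ t : ℝ, f (Circle.exp t) = r t := by
  have : Fact (0 < 2 * Real.pi) := ⟨Real.two_pi_pos⟩
  let e : AddCircle (2 * Real.pi) → ℂ := fun θ ↦ AddCircle.homeomorphCircle' θ
  have he : IsClosedEmbedding e :=
    (Continuous.isClosedEmbedding (by fun_prop)
      (Subtype.val_injective.comp AddCircle.homeomorphCircle'.injective))
  obtain ⟨f, hf⟩ := ContinuousMap.exists_extension' he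
    ⟨hper.lift, continuous_coinduced_dom.2 hr⟩
  exact ⟨f, f.continuous, fun t ↦ congrFun hf (t : AddCircle (2 * Real.pi))⟩

/-- The angular parameter of a simple closed curve extends to a continuous complex function. -/
theorem exists_continuous_angle (hr : Continuous r)
    (hper : Function.Periodic r (2 * Real.pi)) (hinj : InjOn r (Ico 0 (2 * Real.pi))) :
    ∃ h : E → ℂ, Continuous h ∧ ∀ t : ℝ, h (r t) = Circle.exp t := by
  have : Fact (0 < 2 * Real.pi) := ⟨Real.two_pi_pos⟩
  let e : AddCircle (2 * Real.pi) → E := hper.lift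
  have hinj' : Function.Injective e := by
    intro a b hab
    obtain ⟨s, hs, rfl⟩ := AddCircle.coe_image_Ico_eq (2 * Real.pi) 0 ▸ mem_univ a
    obtain ⟨t, ht, rfl⟩ := AddCircle.coe_image_Ico_eq (2 * Real.pi) 0 ▸ mem_univ b
    rw [zero_add] at hs ht
    rw [hinj hs ht hab]
  have he : IsClosedEmbedding e :=
    Continuous.isClosedEmbedding (continuous_coinduced_dom.2 hr) hinj'
  obtain ⟨f, hf⟩ := ContinuousMap.exists_extension' he
    ⟨fun θ ↦ (AddCircle.homeomorphCircle' θ : ℂ), by fun_prop⟩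
  exact ⟨f, f.continuous, fun t ↦ congrFun hf (t : AddCircle (2 * Real.pi))⟩

end

section

variable {E : Type*} [NormedAddCommGroup E] [InnerProductSpace ℝ E] [CompleteSpace E] {u : E → ℝ}

theorem ContDiffAt.continuousAt_gradient {x : E} (h : ContDiffAt ℝ 1 u x) :
    ContinuousAt (gradient u) x :=
  (InnerProductSpace.toDual ℝ E).symm.continuous.continuousAt.comp
    (h.continuousAt_fderiv one_ne_zero)

/-- Near a point where `‖gradient u‖ ^ 2 > m`, short steps along `-gradient u` decrease `u` at rate
at least `m`. -/
theorem eventually_gradient_step_le {x₀ : E} (h : ContDiffAt ℝ 1 u x₀) {m : ℝ}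
    (hm : m < ‖gradient u x₀‖ ^ 2) :
    ∀ᶠ p : ℝ × E in 𝓝 (0, x₀), 0 ≤ p.1 → u (p.2 - p.1 • gradient u p.2) ≤ u p.2 - p.1 * m := by
  set D := fderiv ℝ u x₀
  have hD : D (gradient u x₀) = ‖gradient u x₀‖ ^ 2 := by
    rw [← real_inner_self_eq_norm_sq, inner_gradient_left]
  have hgrad : ContinuousAt (fun p : ℝ × E ↦ gradient u p.2) (0, x₀) :=
    h.continuousAt_gradient.tendsto.comp continuousAt_snd
  obtain ⟨κ, hκ, hκm⟩ : ∃ κ > 0, m < ‖gradient u x₀‖ ^ 2 - κ * ‖gradient u x₀‖ := by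
    have : Tendsto (fun κ : ℝ ↦ ‖gradient u x₀‖ ^ 2 - κ * ‖gradient u x₀‖) (𝓝[>] 0)
        (𝓝 (‖gradient u x₀‖ ^ 2 - 0 * ‖gradient u x₀‖)) :=
      (Continuous.tendsto (by fun_prop) 0).mono_left nhdsWithin_le_nhds
    rw [zero_mul, sub_zero] at this
    exact ((eventually_mem_nhdsWithin).and (this.eventually_const_lt hm)).exists
  have hstep : Tendsto (fun p : ℝ × E ↦ (p.2 - p.1 • gradient u p.2, p.2)) (𝓝 (0, x₀))
      (𝓝 (x₀, x₀)) := by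
    have : ContinuousAt (fun p : ℝ × E ↦ (p.2 - p.1 • gradient u p.2, p.2)) (0, x₀) := by fun_prop
    simpa [ContinuousAt] using this
  have hstrict := hstep.eventually
    (((h.hasStrictFDerivAt one_ne_zero).isLittleO).def hκ)
  have hslope : ∀ᶠ p : ℝ × E in 𝓝 (0, x₀),
      m < D (gradient u p.2) - κ * ‖gradient u p.2‖ := by
    have : ContinuousAt (fun p : ℝ × E ↦ D (gradient u p.2) - κ * ‖gradient u p.2‖) (0, x₀) := by
      fun_prop
    exact this.eventually_const_lt (by simpa only [hD] using hκm)
  filter_upwards [hstrict, hslope] with p hp hp' hs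
  have hp := (Real.norm_eq_abs _ ▸ hp)
  have h1 := (abs_le.1 hp).2
  simp only [sub_sub_cancel_left, map_neg, map_smul, norm_neg, norm_smul, smul_eq_mul,
    Real.norm_of_nonneg hs] at h1
  nlinarith [mul_le_mul_of_nonneg_left hp'.le hs]

/-- **Deformation lemma.** If `u` has no critical points in the compact set `u ⁻¹' Icc a b`, then
a continuous map fixing `{u < a}` pushes a sublevel set slightly above `c ∈ Ioo a b` into one
slightly below `c`. -/
theorem exists_deformation (hu : Continuous u) {a b c : ℝ} (hac : a < c) (hcb : c < b)
    (hcomp : IsCompact (u ⁻¹' Icc a b)) (hdiff : ∀ x ∈ u ⁻¹' Icc a b, ContDiffAt ℝ 1 u x)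
    (hcrit : ∀ x ∈ u ⁻¹' Icc a b, gradient u x ≠ 0) :
    ∃ T : E → E, Continuous T ∧ (∀ x, u x < a → T x = x) ∧
      ∃ δ > 0, ∀ x, u x ≤ c + δ → u (T x) ≤ c - δ := by
  have hgc : ContinuousOn (gradient u) (u ⁻¹' Icc a b) := fun x hx ↦
    (hdiff x hx).continuousAt_gradient.continuousWithinAt
  obtain ⟨m, hm, hmB⟩ : ∃ m > 0, ∀ x ∈ u ⁻¹' Icc a b, m < ‖gradient u x‖ ^ 2 := by
    obtain hB | hB := (u ⁻¹' Icc a b).eq_empty_or_nonempty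
    · exact ⟨1, one_pos, by simp [hB]⟩
    obtain ⟨x, hx, hmin⟩ := hcomp.exists_isMinOn hB (hgc.norm.pow 2)
    have : 0 < ‖gradient u x‖ ^ 2 := by have := norm_pos_iff.2 (hcrit x hx); positivity
    exact ⟨_, half_pos this, fun y hy ↦ (half_lt_self this).trans_le (hmin hy)⟩
  let η : E → ℝ := fun x ↦ max 0 (min (u x - a) (b - u x))
  have hη : Continuous η := by fun_prop
  have hη0 : ∀ x ∉ u ⁻¹' Icc a b, η x = 0 := fun x hx ↦ max_eq_left <| by
    by_contra! h
    exact hx ⟨by linarith [(lt_min_iff.1 h).1], by linarith [(lt_min_iff.1 h).2]⟩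
  have hW : Continuous fun x ↦ η x • gradient u x := by
    refine continuous_iff_continuousAt.2 fun x ↦ ?_
    by_cases hx : x ∈ u ⁻¹' Icc a b
    · exact hη.continuousAt.smul (hdiff x hx).continuousAt_gradient
    · refine (continuousAt_const (y := (0 : E))).congr ?_
      filter_upwards [(isClosed_Icc.preimage hu).isOpen_compl.mem_nhds hx] with y hy
      simp [hη0 y hy]
  have hev := hcomp.eventually_forall_of_forall_eventually
    (P := fun (s : ℝ) x ↦ 0 ≤ s → u (x - s • gradient u x) ≤ u x - s * m)
    fun x hx ↦ eventually_gradient_step_le (hdiff x hx) (hmB x hx)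
  obtain ⟨s₀, hs₀, hstep⟩ := Metric.eventually_nhds_iff.1 hev
  have hba : 0 < b - a := by linarith
  let ε := s₀ / 2 / (b - a)
  have hε : 0 < ε := by positivity
  have hηle : ∀ x, η x ≤ b - a := fun x ↦ max_le hba.le <| by
    rcases le_total (u x) b with h | h
    · exact (min_le_left _ _).trans (by linarith)
    · exact (min_le_right _ _).trans (by linarith)
  have hη_nonneg : ∀ x, 0 ≤ η x := fun x ↦ le_max_left _ _
  have hdec : ∀ x, u (x - ε • η x • gradient u x) ≤ u x - ε * η x * m := fun x ↦ by
    by_cases hx : x ∈ u ⁻¹' Icc a b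
    · have h0 : 0 ≤ ε * η x := mul_nonneg hε.le (hη_nonneg x)
      have h1 : ε * η x ≤ s₀ / 2 :=
        (mul_le_mul_of_nonneg_left (hηle x) hε.le).trans_eq (div_mul_cancel₀ _ hba.ne')
      rw [smul_smul]
      exact hstep (by rw [Real.dist_0_eq_abs, abs_of_nonneg h0]; linarith) x hx h0
    · simp [hη0 x hx]
  let d := min (c - a) (b - c) / 2
  have hd : 0 < d := half_pos (lt_min (by linarith) (by linarith))
  have hda : 2 * d ≤ c - a := by have := min_le_left (c - a) (b - c); simp only [d]; linarith
  have hdb : 2 * d ≤ b - c := by have := min_le_right (c - a) (b - c); simp only [d]; linarith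
  refine ⟨fun x ↦ x - ε • η x • gradient u x, by fun_prop, fun x hx ↦ ?_,
    min d (ε * d * m / 2), by positivity, fun x hx ↦ (hdec x).trans ?_⟩
  · simp [hη0 x fun h ↦ absurd h.1 hx.not_ge]
  have h1 := min_le_left d (ε * d * m / 2)
  have h2 := min_le_right d (ε * d * m / 2)
  rcases le_total (u x) (c - min d (ε * d * m / 2)) with h | h
  · have : 0 ≤ ε * η x * m := by have := hη_nonneg x; positivity
    linarith
  · have : d ≤ η x := le_max_of_le_right (le_min (by linarith) (by linarith))
    have : ε * d * m ≤ ε * η x * m := by gcongr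
    linarith

end

open intervalIntegral in
/-- Differentiation under the integral sign on an open set, with continuity of the derivative. -/
theorem hasFDerivAt_intervalIntegral_of_continuousOn {E F : Type*} [NormedAddCommGroup E]
    [NormedSpace ℝ E] [ProperSpace E] [NormedAddCommGroup F] [NormedSpace ℝ F]
    {U : Set E} (hU : IsOpen U) {f : E → ℝ → F} {f' : E → ℝ → E →L[ℝ] F}
    (hf : ContinuousOn (Function.uncurry f) (U ×ˢ univ))
    (hf' : ContinuousOn (Function.uncurry f') (U ×ˢ univ))
    (hd : ∀ x ∈ U, ∀ t, HasFDerivAt (f · t) (f' x t) x) (a b : ℝ) {x : E} (hx : x ∈ U) :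
    HasFDerivAt (fun x ↦ ∫ t in a..b, f x t) (∫ t in a..b, f' x t) x ∧
      ContinuousAt (fun x ↦ ∫ t in a..b, f' x t) x := by
  obtain ⟨ε, hε, hεU⟩ := Metric.nhds_basis_closedBall.mem_iff.1 (hU.mem_nhds hx)
  have hfc : ∀ y ∈ U, Continuous (f y) := fun y hy ↦
    hf.comp_continuous (f := fun t ↦ (y, t)) (by fun_prop) fun t ↦ ⟨hy, mem_univ t⟩
  have hf'c : ∀ y ∈ U, Continuous (f' y) := fun y hy ↦
    hf'.comp_continuous (f := fun t ↦ (y, t)) (by fun_prop) fun t ↦ ⟨hy, mem_univ t⟩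
  obtain ⟨C, hC⟩ := ((isCompact_closedBall x ε).prod (isCompact_uIcc (a := a) (b := b))
    ).exists_bound_of_continuousOn (hf'.mono (prod_mono hεU (subset_univ _)))
  have hnhds := Metric.closedBall_mem_nhds x hε
  have hbound : ∀ t ∈ uIoc a b, ∀ y ∈ Metric.closedBall x ε, ‖f' y t‖ ≤ C := fun t ht y hy ↦
    hC (y, t) ⟨hy, uIoc_subset_uIcc ht⟩
  constructor
  · exact hasFDerivAt_integral_of_dominated_of_fderiv_le (bound := fun _ ↦ C) hnhds
      (Eventually.mono hnhds fun y hy ↦ (hfc y (hεU hy)).aestronglyMeasurable)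
      ((hfc x hx).intervalIntegrable _ _) (hf'c x hx).aestronglyMeasurable
      (Eventually.of_forall hbound) intervalIntegrable_const
      (Eventually.of_forall fun t _ y hy ↦ hd y (hεU hy) t)
  · refine continuousAt_of_dominated_interval (bound := fun _ ↦ C)
      (Eventually.mono hnhds fun y hy ↦ (hf'c y (hεU hy)).aestronglyMeasurable)
      (Eventually.mono hnhds fun y hy ↦ Eventually.of_forall fun t ht ↦ hbound t ht y hy)
      intervalIntegrable_const (Eventually.of_forall fun t _ ↦ ?_)
    exact (hf'.comp (f := fun y ↦ (y, t)) (s := U) (by fun_prop)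
      fun y hy ↦ ⟨hy, mem_univ t⟩).continuousAt (hU.mem_nhds hx)

section

variable {E : Type*} [NormedAddCommGroup E] [InnerProductSpace ℝ E] {r : ℝ → E}

/-- The potential of a curve is continuously differentiable off the curve. -/
theorem contDiffAt_potential [ProperSpace E] (hr : ContDiff ℝ 1 r) (hK : IsClosed (range r))
    (a b : ℝ) {x : E} (hx : x ∉ range r) :
    ContDiffAt ℝ 1 (fun x ↦ ∫ t in a..b, ‖deriv r t‖ / ‖x - r t‖) x := by
  have hrc := hr.continuous
  have hr'c : Continuous (deriv r) := hr.continuous_deriv le_rfl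
  have hne : ∀ y ∈ (range r)ᶜ, ∀ t, y - r t ≠ 0 := fun y hy t h ↦
    hy ⟨t, (sub_eq_zero.1 h).symm⟩
  let f' : E → ℝ → E →L[ℝ] ℝ := fun y t ↦
    -(‖deriv r t‖ / ‖y - r t‖ ^ 3) • innerSL ℝ (y - r t)
  have hd : ∀ y ∈ (range r)ᶜ, ∀ t,
      HasFDerivAt (fun y ↦ ‖deriv r t‖ / ‖y - r t‖) (f' y t) y := fun y hy t ↦ by
    have h0 := norm_ne_zero_iff.2 (hne y hy t)
    have hs := (((hasFDerivAt_id y).sub_const (r t)).norm_sq).sqrt (pow_ne_zero 2 h0)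
    simp only [Real.sqrt_sq (norm_nonneg _), id] at hs
    have := (hasDerivAt_inv h0).comp_hasFDerivAt y hs |>.const_mul ‖deriv r t‖
    refine this.congr_fderiv ?_
    ext v
    simp [f']
    field_simp
  have hfc : ContinuousOn (Function.uncurry fun y t ↦ ‖deriv r t‖ / ‖y - r t‖)
      ((range r)ᶜ ×ˢ univ) :=
    ContinuousOn.div (by fun_prop) (by fun_prop) fun p hp ↦ norm_ne_zero_iff.2 (hne _ hp.1 _)
  have hf'c : ContinuousOn (Function.uncurry f') ((range r)ᶜ ×ˢ univ) :=
    (ContinuousOn.div (by fun_prop) (by fun_prop) fun p hp ↦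
      pow_ne_zero 3 (norm_ne_zero_iff.2 (hne _ hp.1 _))).neg.smul (by fun_prop)
  have key := fun y hy ↦
    hasFDerivAt_intervalIntegral_of_continuousOn hK.isOpen_compl hfc hf'c hd a b (x := y) hy
  exact contDiffAt_one_iff.2 ⟨_, _, hK.isOpen_compl.mem_nhds hx,
    fun y hy ↦ (key y hy).2.continuousWithinAt, fun y hy ↦ (key y hy).1⟩

theorem continuous_potential_integrand (hr : ContDiff ℝ 1 r) {x : E} (hx : x ∉ range r) :
    Continuous fun t ↦ ‖deriv r t‖ / ‖x - r t‖ := by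
  have hrc := hr.continuous
  have hr'c : Continuous (deriv r) := hr.continuous_deriv le_rfl
  exact .div (by fun_prop) (by fun_prop) fun t h ↦
    hx ⟨t, (sub_eq_zero.1 (norm_eq_zero.1 h)).symm⟩

theorem potential_pos (hr : ContDiff ℝ 1 r) (hr' : ∀ t, deriv r t ≠ 0) {a b : ℝ} (hab : a < b)
    {x : E} (hx : x ∉ range r) : 0 < ∫ t in a..b, ‖deriv r t‖ / ‖x - r t‖ :=
  intervalIntegral.intervalIntegral_pos_of_pos_on
    ((continuous_potential_integrand hr hx).intervalIntegrable _ _)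
    (fun t _ ↦ div_pos (norm_pos_iff.2 (hr' t))
      (norm_pos_iff.2 fun h ↦ hx ⟨t, (sub_eq_zero.1 h).symm⟩)) hab

/-- The potential of a closed regular curve blows up at the curve. -/
theorem tendsto_potential_nhdsWithin (hr : ContDiff ℝ 1 r) (hr' : ∀ t, deriv r t ≠ 0) {T : ℝ}
    (hT : 0 < T) (hper : Function.Periodic r T) {y : E} (hy : y ∈ range r) :
    Tendsto (fun x ↦ ∫ t in (0 : ℝ)..T, ‖deriv r t‖ / ‖x - r t‖) (𝓝[(range r)ᶜ] y) atTop := by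
  obtain ⟨t₀, rfl⟩ := hy
  have hr'c : Continuous (deriv r) := hr.continuous_deriv le_rfl
  have hcomp : IsCompact (Icc t₀ (t₀ + T)) := isCompact_Icc
  have hle : t₀ ≤ t₀ + T := by linarith
  obtain ⟨m, hm, hmle⟩ : ∃ m > 0, ∀ t ∈ Icc t₀ (t₀ + T), m ≤ ‖deriv r t‖ := by
    obtain ⟨t, -, ht⟩ := hcomp.exists_isMinOn (nonempty_Icc.2 hle) hr'c.norm.continuousOn
    exact ⟨_, norm_pos_iff.2 (hr' t), ht⟩
  obtain ⟨C, hC⟩ := hcomp.exists_bound_of_continuousOn hr'c.continuousOn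
  have hCpos : 0 < C := hm.trans_le
    ((hmle t₀ (left_mem_Icc.2 hle)).trans (hC t₀ (left_mem_Icc.2 hle)))
  have hlip : ∀ t ∈ Icc t₀ (t₀ + T), ‖r t - r t₀‖ ≤ C * (t - t₀) := fun t ht ↦ by
    have := (convex_Icc t₀ (t₀ + T)).norm_image_sub_le_of_norm_deriv_le
      (fun s _ ↦ (hr.differentiable one_ne_zero) s) hC (left_mem_Icc.2 hle) ht
    rwa [Real.norm_of_nonneg (sub_nonneg.2 ht.1)] at this
  have hper' : Function.Periodic (deriv r) T := fun t ↦ by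
    rw [← deriv_comp_add_const, show (fun s ↦ r (s + T)) = r from funext hper]
  have hlower : ∀ x ∉ range r, m / C * Real.log ((‖x - r t₀‖ + C * T) / ‖x - r t₀‖) ≤
      ∫ t in (0 : ℝ)..T, ‖deriv r t‖ / ‖x - r t‖ := fun x hx ↦ by
    have hd : 0 < ‖x - r t₀‖ := norm_pos_iff.2 fun h ↦ hx ⟨t₀, (sub_eq_zero.1 h).symm⟩
    have hden : ∀ t ∈ Icc t₀ (t₀ + T), 0 < ‖x - r t₀‖ + C * (t - t₀) := fun t ht ↦
      add_pos_of_pos_of_nonneg hd (mul_nonneg hCpos.le (sub_nonneg.2 ht.1))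
    have hint : IntervalIntegrable (fun t ↦ m / (‖x - r t₀‖ + C * (t - t₀))) MeasureTheory.volume
        t₀ (t₀ + T) :=
      ContinuousOn.intervalIntegrable_of_Icc hle
        (ContinuousOn.div (by fun_prop) (by fun_prop) fun t ht ↦ (hden t ht).ne')
    have hval : ∫ t in t₀..(t₀ + T), m / (‖x - r t₀‖ + C * (t - t₀)) =
        m / C * Real.log ((‖x - r t₀‖ + C * T) / ‖x - r t₀‖) := by
      rw [intervalIntegral.integral_eq_sub_of_hasDerivAt
        (f := fun t ↦ m / C * Real.log (‖x - r t₀‖ + C * (t - t₀))) (fun t ht ↦ ?_) hint,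
        Real.log_div (by positivity) hd.ne']
      · simp [mul_sub]
      · rw [uIcc_of_le hle] at ht
        have h1 : HasDerivAt (fun t ↦ ‖x - r t₀‖ + C * (t - t₀)) C t := by
          simpa using (((hasDerivAt_id t).sub_const t₀).const_mul C).const_add ‖x - r t₀‖
        refine ((h1.log (hden t ht).ne').const_mul (m / C)).congr_deriv ?_
        have := (hden t ht).ne'
        field_simp
    have hshift := Function.Periodic.intervalIntegral_add_eq
      (f := fun t ↦ ‖deriv r t‖ / ‖x - r t‖) (T := T) (fun t ↦ by simp only [hper t, hper' t]) 0 t₀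
    rw [zero_add] at hshift
    rw [← hval, hshift]
    refine intervalIntegral.integral_mono_on hle hint
      ((continuous_potential_integrand hr hx).intervalIntegrable _ _) fun t ht ↦ ?_
    refine div_le_div₀ (norm_nonneg _) (hmle t ht)
      (norm_pos_iff.2 fun h ↦ hx ⟨t, (sub_eq_zero.1 h).symm⟩) ?_
    calc ‖x - r t‖ ≤ ‖x - r t₀‖ + ‖r t₀ - r t‖ := norm_sub_le_norm_sub_add_norm_sub ..
      _ ≤ _ := by rw [norm_sub_rev (r t₀)]; linarith [hlip t ht]
  refine tendsto_atTop_mono' _ (eventually_nhdsWithin_of_forall hlower) ?_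
  refine (Real.tendsto_log_atTop.comp ?_).const_mul_atTop (div_pos hm hCpos)
  have hnum : Tendsto (fun x ↦ ‖x - r t₀‖ + C * T) (𝓝[(range r)ᶜ] r t₀) (𝓝 (C * T)) := by
    have : Continuous fun x ↦ ‖x - r t₀‖ + C * T := by fun_prop
    simpa using (this.tendsto (r t₀)).mono_left nhdsWithin_le_nhds
  have hden : Tendsto (fun x ↦ ‖x - r t₀‖) (𝓝[(range r)ᶜ] r t₀) (𝓝[>] 0) := by
    refine tendsto_nhdsWithin_iff.2 ⟨?_, eventually_nhdsWithin_of_forall fun x hx ↦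
      norm_pos_iff.2 fun h ↦ hx ⟨t₀, (sub_eq_zero.1 h).symm⟩⟩
    have : Continuous fun x ↦ ‖x - r t₀‖ := by fun_prop
    simpa using (this.tendsto (r t₀)).mono_left nhdsWithin_le_nhds
  simp only [div_eq_mul_inv]
  exact hnum.pos_mul_atTop (by positivity) hden.inv_tendsto_nhdsGT_zero

/-- The potential of a bounded curve vanishes at infinity. -/
theorem tendsto_potential_cocompact [ProperSpace E] (hr : ContDiff ℝ 1 r)
    (hK : IsCompact (range r)) (a b : ℝ) :
    Tendsto (fun x ↦ ∫ t in a..b, ‖deriv r t‖ / ‖x - r t‖) (cocompact E) (𝓝 0) := by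
  have hr'c : Continuous (deriv r) := hr.continuous_deriv le_rfl
  obtain ⟨R, hR⟩ := hK.isBounded.exists_norm_le
  obtain ⟨C, hC⟩ := (isCompact_uIcc (a := a) (b := b)).exists_bound_of_continuousOn
    hr'c.continuousOn
  have hnorm : Tendsto (fun x : E ↦ ‖x‖ - R) (cocompact E) atTop :=
    tendsto_atTop_add_const_right _ _ tendsto_norm_cocompact_atTop
  have hlim : Tendsto (fun x : E ↦ C / (‖x‖ - R) * |b - a|) (cocompact E) (𝓝 0) := by
    simpa using (hnorm.const_div_atTop C).mul_const |b - a|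
  refine squeeze_zero_norm' ?_ hlim
  filter_upwards [hnorm.eventually_gt_atTop 0] with x hx
  refine intervalIntegral.norm_integral_le_of_norm_le_const fun t ht ↦ ?_
  rw [norm_div, norm_norm, norm_norm]
  have h1 := hC t (uIoc_subset_uIcc ht)
  exact div_le_div₀ ((norm_nonneg _).trans h1) h1 hx
    (by linarith [norm_sub_norm_le x (r t), hR _ (mem_range_self t)])

end

section

variable {E : Type*} [NormedAddCommGroup E] [InnerProductSpace ℝ E] [FiniteDimensional ℝ E]
  {r : ℝ → E} {u : E → ℝ}

/-- A proper nonnegative function whose zero set is a simple closed curve, and which is `C¹` off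
that curve, has a critical point off the curve. -/
theorem exists_gradient_eq_zero_of_zeros_eq_loop (hr : Continuous r)
    (hper : Function.Periodic r (2 * Real.pi)) (hinj : InjOn r (Ico 0 (2 * Real.pi)))
    (hu : Continuous u) (hprop : Tendsto u (cocompact E) atTop) (hnonneg : ∀ x, 0 ≤ u x)
    (hzero : ∀ x, u x = 0 ↔ x ∈ range r) (hdiff : ∀ x ∉ range r, ContDiffAt ℝ 1 u x) :
    ∃ x ∉ range r, gradient u x = 0 := by
  have := FiniteDimensional.proper_real E
  by_contra! hcrit
  have hcomp : ∀ s : Set ℝ, IsClosed s → BddAbove s → IsCompact (u ⁻¹' s) := fun s hs ⟨M, hM⟩ ↦ by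
    obtain ⟨t, ht, hts⟩ := mem_cocompact.1 (hprop.eventually_gt_atTop M)
    refine ht.of_isClosed_subset (hs.preimage hu) fun x hx ↦ ?_
    by_contra h
    exact (hM hx).not_gt (hts h)
  let A : Set ℝ := {c | ∃ f : ℂ → E, Continuous f ∧ (∀ t : ℝ, f (Circle.exp t) = r t) ∧
    ∀ z ∈ Metric.closedBall (0 : ℂ) 1, u (f z) ≤ c}
  have hA : A.Nonempty := by
    obtain ⟨f, hf, hfr⟩ := exists_continuous_extend_loop hr hper
    obtain ⟨c, hc⟩ := ((isCompact_closedBall (0 : ℂ) 1).image (hu.comp hf)).bddAbove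
    exact ⟨c, f, hf, hfr, fun z hz ↦ hc (mem_image_of_mem _ hz)⟩
  obtain ⟨c₀, hc₀, hAc₀⟩ : ∃ c₀ > 0, ∀ c ∈ A, c₀ ≤ c := by
    obtain ⟨h, hh, hhr⟩ := exists_continuous_angle hr hper hinj
    have hZ : IsCompact (u ⁻¹' Iic 1 ∩ h ⁻¹' {0}) :=
      (hcomp _ isClosed_Iic bddAbove_Iic).inter_right (isClosed_singleton.preimage hh)
    obtain ⟨c₀, hc₀, hlt⟩ : ∃ c₀ > 0, ∀ x ∈ u ⁻¹' Iic 1 ∩ h ⁻¹' {0}, c₀ ≤ u x := by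
      obtain hZ' | hZ' := (u ⁻¹' Iic 1 ∩ h ⁻¹' {0}).eq_empty_or_nonempty
      · exact ⟨1, one_pos, by simp [hZ']⟩
      obtain ⟨x, hx, hmin⟩ := hZ.exists_isMinOn hZ' hu.continuousOn
      refine ⟨u x, (hnonneg x).lt_of_ne' fun h0 ↦ ?_, hmin⟩
      obtain ⟨t, rfl⟩ := (hzero x).1 h0
      exact Circle.coe_ne_zero _ ((hhr t).symm.trans hx.2)
    refine ⟨min c₀ 1, lt_min hc₀ one_pos, fun c ⟨f, hf, hfr, hfc⟩ ↦ ?_⟩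
    obtain ⟨z, hz, hz0⟩ := exists_zero_of_fix_circle (hh.comp hf) fun t ↦ by
      rw [Function.comp_apply, hfr, hhr]
    rcases le_total (u (f z)) 1 with h1 | h1
    · exact (min_le_left _ _).trans ((hlt _ ⟨h1, hz0⟩).trans (hfc z hz))
    · exact (min_le_right _ _).trans (h1.trans (hfc z hz))
  have hAbdd : BddBelow A := ⟨c₀, hAc₀⟩
  have hc : 0 < sInf A := hc₀.trans_le (le_csInf hA hAc₀)
  have hB : ∀ x ∈ u ⁻¹' Icc (sInf A / 2) (sInf A + 1), x ∉ range r := fun x hx hxr ↦ by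
    have h1 := hx.1
    rw [(hzero x).2 hxr] at h1
    linarith
  obtain ⟨T, hT, hfix, δ, hδ, hTδ⟩ := exists_deformation hu (half_lt_self hc)
    (lt_add_one (sInf A)) (hcomp _ isClosed_Icc bddAbove_Icc) (fun x hx ↦ hdiff x (hB x hx))
    fun x hx ↦ hcrit x (hB x hx)
  obtain ⟨c, ⟨f, hf, hfr, hfc⟩, hcδ⟩ := exists_lt_of_csInf_lt hA (lt_add_of_pos_right (sInf A) hδ)
  have hmem : sInf A - δ ∈ A := by
    refine ⟨T ∘ f, hT.comp hf, fun t ↦ ?_, fun z hz ↦ hTδ _ ((hfc z hz).trans hcδ.le)⟩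
    rw [Function.comp_apply, hfr, hfix]
    rw [(hzero _).2 (mem_range_self t)]
    exact half_pos hc
  linarith [csInf_le hAbdd hmem]

end

/-- The electric potential of a knot always has at least one critical point
in `ℝ³`. -/
theorem exists_critical_point
    (r : ℝ → EuclideanSpace ℝ (Fin 3))
    (hr : ContDiff ℝ (⊤ : ℕ∞) r)
    (hper : Function.Periodic r (2 * Real.pi))
    (hinj : Set.InjOn r (Set.Ico 0 (2 * Real.pi)))
    (hr' : ∀ t, deriv r t ≠ 0)
    (K : Set (EuclideanSpace ℝ (Fin 3))) (hK : K = Set.range r)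
    (Φ : EuclideanSpace ℝ (Fin 3) → ℝ)
    (hΦ : ∀ x, Φ x = ∫ t in (0:ℝ)..(2 * Real.pi), ‖deriv r t‖ / ‖x - r t‖) :
    ∃ x ∉ K, gradient Φ x = 0 := by
  classical
  subst hK
  obtain rfl := funext hΦ
  set Φ : EuclideanSpace ℝ (Fin 3) → ℝ :=
    fun x ↦ ∫ t in (0:ℝ)..(2 * Real.pi), ‖deriv r t‖ / ‖x - r t‖
  have hr₁ : ContDiff ℝ 1 r := hr.of_le (by exact_mod_cast le_top)
  have hcompact : IsCompact (range r) :=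
    hper.compact_of_continuous Real.two_pi_pos.ne' hr.continuous
  have hpos : ∀ x ∉ range r, 0 < Φ x := fun x hx ↦ potential_pos hr₁ hr' Real.two_pi_pos hx
  have hdiff : ∀ x ∉ range r, ContDiffAt ℝ 1 Φ x := fun x hx ↦
    contDiffAt_potential hr₁ hcompact.isClosed _ _ hx
  let u : EuclideanSpace ℝ (Fin 3) → ℝ := fun x ↦ if x ∈ range r then 0 else (Φ x)⁻¹
  have hu_eq : ∀ x ∉ range r, u =ᶠ[𝓝 x] fun x ↦ (Φ x)⁻¹ := fun x hx ↦ by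
    filter_upwards [hcompact.isClosed.isOpen_compl.mem_nhds hx] with y hy using if_neg hy
  have hu_diff : ∀ x ∉ range r, ContDiffAt ℝ 1 u x := fun x hx ↦
    ((hdiff x hx).inv (hpos x hx).ne').congr_of_eventuallyEq (hu_eq x hx)
  have hu_cont : Continuous u := by
    refine continuous_iff_continuousAt.2 fun x ↦ ?_
    by_cases hx : x ∈ range r
    · have h0 : u x = 0 := if_pos hx
      rw [ContinuousAt, h0, ← nhdsWithin_univ, ← union_compl_self (range r), nhdsWithin_union]
      refine .sup (tendsto_const_nhds.congr' (eventually_nhdsWithin_of_forall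
        fun y hy ↦ (if_pos hy).symm)) ?_
      exact (tendsto_potential_nhdsWithin hr₁ hr' Real.two_pi_pos hper hx).inv_tendsto_atTop.congr'
        (eventually_nhdsWithin_of_forall fun y hy ↦ (if_neg hy).symm)
    · exact (hu_diff x hx).continuousAt
  have hout : ∀ᶠ x in cocompact _, x ∉ range r := hcompact.compl_mem_cocompact
  have hu_prop : Tendsto u (cocompact _) atTop := by
    have h0 : Tendsto Φ (cocompact _) (𝓝[>] 0) := tendsto_nhdsWithin_iff.2
      ⟨tendsto_potential_cocompact hr₁ hcompact _ _, hout.mono hpos⟩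
    exact h0.inv_tendsto_nhdsGT_zero.congr' (hout.mono fun y hy ↦ (if_neg hy).symm)
  obtain ⟨x, hx, hcrit⟩ := exists_gradient_eq_zero_of_zeros_eq_loop hr.continuous hper hinj hu_cont
    hu_prop (fun x ↦ by
      by_cases hx : x ∈ range r
      · exact (if_pos hx).ge
      · exact (inv_pos.2 (hpos x hx)).le.trans_eq (if_neg hx).symm)
    (fun x ↦ by
      by_cases hx : x ∈ range r
      · exact iff_of_true (if_pos hx) hx
      · exact iff_of_false (fun h ↦ (inv_pos.2 (hpos x hx)).ne' ((if_neg hx).symm.trans h)) hx)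
    hu_diff
  refine ⟨x, hx, ?_⟩
  have hfu : fderiv ℝ u x = 0 := by simpa [gradient] using hcrit
  have hΦd := ((hdiff x hx).differentiableAt one_ne_zero).hasFDerivAt
  have hinv : HasFDerivAt (fun x ↦ (Φ x)⁻¹) (-(Φ x ^ 2)⁻¹ • fderiv ℝ Φ x) x :=
    (hasDerivAt_inv (hpos x hx).ne').comp_hasFDerivAt x hΦd
  rw [(hu_eq x hx).fderiv_eq, hinv.fderiv] at hfu
  have : fderiv ℝ Φ x = 0 := (smul_eq_zero.1 hfu).resolve_left (by simp [(hpos x hx).ne'])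
  simp [gradient, this]
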